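/- arXiv:1904.04477 — 4 statements merged into one kernel-verified Lean document; each statement's English description precedes it below -/
import Mathlib

section
/- Let p, q be positive integers. Then the type-I domain D^I_{p,q} = {Z ∈ M(p,q;ℂ) : I_q − ZᴴZ is positive definite} is an open and bounded subset of the complex vector space M(p,q;ℂ) of p×q complex matrices. -/
open Matrix
open scoped ComplexOrder

/-- The type-I bounded symmetric domain
`D^I_{p,q} = {Z ∈ M(p,q;ℂ) : I_q − ZᴴZ > 0}`. -/
def typeIDomain (p q : ℕ) : Set (Matrix (Fin p) (Fin q) ℂ) :=
  {Z | (1 - Zᴴ * Z).PosDef}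

/-- A Hermitian matrix is positive definite as soon as its quadratic form has positive real part
on the unit sphere. -/
lemma Matrix.IsHermitian.posDef_iff_re_pos_on_sphere {n 𝕜 : Type*} [Fintype n] [RCLike 𝕜]
    {A : Matrix n n 𝕜} (hA : A.IsHermitian) :
    A.PosDef ↔ ∀ x ∈ Metric.sphere (0 : n → 𝕜) 1, 0 < RCLike.re (star x ⬝ᵥ (A *ᵥ x)) := by
  refine ⟨fun h x hx ↦ h.re_dotProduct_pos (ne_zero_of_mem_unit_sphere ⟨x, hx⟩), fun h ↦ ?_⟩
  refine .of_dotProduct_mulVec_pos hA fun x hx ↦ ?_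
  rw [RCLike.pos_iff]
  refine ⟨?_, hA.im_star_dotProduct_mulVec_self x⟩
  have hx' : 0 < ‖x‖ := norm_pos_iff.2 hx
  have hsphere : ((‖x‖⁻¹ : ℝ) • x) ∈ Metric.sphere (0 : n → 𝕜) 1 := by
    simp [norm_smul, hx'.ne']
  have hpos := h _ hsphere
  rw [mulVec_smul, star_smul, smul_dotProduct, dotProduct_smul, RCLike.smul_re,
    RCLike.smul_re] at hpos
  simp only [star_trivial] at hpos
  exact pos_of_mul_pos_right (pos_of_mul_pos_right hpos (by positivity)) (by positivity)

/-- Positive definiteness is an open condition on a continuous family of Hermitian matrices. -/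
lemma Matrix.isOpen_setOf_posDef {X n 𝕜 : Type*} [TopologicalSpace X] [Fintype n] [RCLike 𝕜]
    {f : X → Matrix n n 𝕜} (hf : Continuous f) (hH : ∀ x, (f x).IsHermitian) :
    IsOpen {x | (f x).PosDef} := by
  simp only [(hH _).posDef_iff_re_pos_on_sphere]
  refine isOpen_iff_mem_nhds.2 fun x hx ↦ ?_
  refine (isCompact_sphere (0 : n → 𝕜) 1).eventually_forall_of_forall_eventually fun y hy ↦ ?_
  have hcont : Continuous fun z : X × (n → 𝕜) ↦
      RCLike.re (star z.2 ⬝ᵥ (f z.1 *ᵥ z.2)) := by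
    exact RCLike.continuous_re.comp <| continuous_snd.star.dotProduct <|
      (hf.comp continuous_fst).matrix_mulVec continuous_snd
  exact hcont.continuousAt.eventually_const_lt (hx y hy)

/-- If `1 - Zᴴ * Z` is positive definite, then every entry of `Z` has norm less than `1`. -/
lemma Matrix.norm_apply_lt_one_of_posDef_one_sub {m n 𝕜 : Type*} [Fintype m] [DecidableEq n]
    [RCLike 𝕜] {Z : Matrix m n 𝕜} (hZ : (1 - Zᴴ * Z).PosDef) (i : m) (j : n) :
    ‖Z i j‖ < 1 := by
  have hdiag : (0 : 𝕜) < ((1 - ∑ k, ‖Z k j‖ ^ 2 : ℝ) : 𝕜) := by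
    simpa [mul_apply, RCLike.conj_mul] using hZ.diag_pos (i := j)
  have hsum : ∑ k, ‖Z k j‖ ^ 2 < 1 := sub_pos.1 (RCLike.ofReal_pos.1 hdiag)
  have hle : ‖Z i j‖ ^ 2 ≤ ∑ k, ‖Z k j‖ ^ 2 :=
    Finset.single_le_sum (f := fun k ↦ ‖Z k j‖ ^ 2) (fun _ _ ↦ by positivity) (Finset.mem_univ i)
  exact (sq_lt_one_iff₀ (norm_nonneg _)).1 (hle.trans_lt hsum)

/-- `D^I_{p,q}` is an open and bounded subset of `M(p,q;ℂ)`
(boundedness: the entries of its elements are uniformly bounded). -/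
theorem typeIDomain_isOpen_and_bounded (p q : ℕ) (hp : 0 < p) (hq : 0 < q) :
    IsOpen (typeIDomain p q) ∧
    ∃ C : ℝ, ∀ Z ∈ typeIDomain p q, ∀ (i : Fin p) (j : Fin q), ‖Z i j‖ ≤ C := by
  exact ⟨isOpen_setOf_posDef (by fun_prop)
      fun Z ↦ isHermitian_one.sub (isHermitian_conjTranspose_mul_self Z),
    1, fun _ hZ i j ↦ (norm_apply_lt_one_of_posDef_one_sub hZ i j).le⟩
end

section
/- Let p₁,…,p₄, q₁,…,q₄ be positive integers with p_j ≤ q_j for 1 ≤ j ≤ 4, and define f : M(p₁,q₁;ℂ)×M(p₂,q₂;ℂ)×M(p₃,q₃;ℂ)×M(p₄,q₄;ℂ) → M(p₁+p₂,q₁+q₂;ℂ)×M(p₃+p₄,q₃+q₄;ℂ) by f(Z¹,Z²,Z³,Z⁴) = ([[Z¹,0],[0,Z²]], [[Z³,0],[0,Z⁴]]). Then f restricts to a proper holomorphic map from D^I_{p₁,q₁} × D^I_{p₂,q₂} × D^I_{p₃,q₃} × D^I_{p₄,q₄} to D^I_{p₁+p₂,q₁+q₂} × D^I_{p₃+p₄,q₃+q₄}: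 it is holomorphic, maps the product of the four type-I domains into the product of the two type-I domains, and, with the subspace topologies, preimages of compact sets are compact. -/
open Matrix
open scoped ComplexOrder

attribute [local instance] Matrix.normedAddCommGroup Matrix.normedSpace

/-- The block-diagonal matrix `[[A,0],[0,B]]` as a `(p₁+p₂) × (q₁+q₂)` matrix. -/
def blockDiagMat {p₁ q₁ p₂ q₂ : ℕ}
    (A : Matrix (Fin p₁) (Fin q₁) ℂ) (B : Matrix (Fin p₂) (Fin q₂) ℂ) :
    Matrix (Fin (p₁ + p₂)) (Fin (q₁ + q₂)) ℂ :=
  Matrix.reindex finSumFinEquiv finSumFinEquiv (Matrix.fromBlocks A 0 0 B)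

theorem Matrix.posDef_fromBlocks_zero_zero_iff {m n : Type*} [Fintype m] [Fintype n]
    {A : Matrix m m ℂ} {B : Matrix n n ℂ} :
    (fromBlocks A 0 0 B).PosDef ↔ A.PosDef ∧ B.PosDef := by
  refine ⟨fun h => ⟨h.submatrix Sum.inl_injective, h.submatrix Sum.inr_injective⟩,
    fun ⟨hA, hB⟩ => .of_dotProduct_mulVec_pos ?_ fun x hx => ?_⟩
  · rw [IsHermitian, fromBlocks_conjTranspose, hA.1.eq, hB.1.eq, conjTranspose_zero,
      conjTranspose_zero]
  · have key : star x ⬝ᵥ (fromBlocks A 0 0 B *ᵥ x) =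
        star (x ∘ Sum.inl) ⬝ᵥ (A *ᵥ (x ∘ Sum.inl)) +
          star (x ∘ Sum.inr) ⬝ᵥ (B *ᵥ (x ∘ Sum.inr)) := by
      simp [fromBlocks_mulVec, dotProduct, Fintype.sum_sum_type]
    rw [key]
    by_cases hl : x ∘ Sum.inl = 0
    · have hr : x ∘ Sum.inr ≠ 0 := fun hr =>
        hx (funext (Sum.rec (congrFun hl) (congrFun hr)))
      exact add_pos_of_nonneg_of_pos (hA.posSemidef.dotProduct_mulVec_nonneg _)
        (hB.dotProduct_mulVec_pos hr)
    · exact add_pos_of_pos_of_nonneg (hA.dotProduct_mulVec_pos hl)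
        (hB.posSemidef.dotProduct_mulVec_nonneg _)

theorem blockDiagMat_mem_typeIDomain_iff {p₁ q₁ p₂ q₂ : ℕ}
    {A : Matrix (Fin p₁) (Fin q₁) ℂ} {B : Matrix (Fin p₂) (Fin q₂) ℂ} :
    blockDiagMat A B ∈ typeIDomain (p₁ + p₂) (q₁ + q₂) ↔
      A ∈ typeIDomain p₁ q₁ ∧ B ∈ typeIDomain p₂ q₂ := by
  have key : 1 - (blockDiagMat A B)ᴴ * blockDiagMat A B =
      (fromBlocks (1 - Aᴴ * A) 0 0 (1 - Bᴴ * B)).submatrix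
        finSumFinEquiv.symm finSumFinEquiv.symm := by
    have hsub : fromBlocks (1 - Aᴴ * A) 0 0 (1 - Bᴴ * B) =
        1 - (fromBlocks A 0 0 B)ᴴ * fromBlocks A 0 0 B := by
      rw [fromBlocks_conjTranspose, fromBlocks_multiply]
      ext (i | i) (j | j) <;> simp [one_apply]
    rw [blockDiagMat, conjTranspose_reindex, reindex_apply, reindex_apply, submatrix_mul_equiv,
      ← submatrix_one_equiv finSumFinEquiv.symm, hsub]
    rfl
  change (1 - (blockDiagMat A B)ᴴ * blockDiagMat A B).PosDef ↔
    (1 - Aᴴ * A).PosDef ∧ (1 - Bᴴ * B).PosDef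
  rw [key, ← posDef_fromBlocks_zero_zero_iff]
  refine ⟨fun h => ?_, fun h => h.submatrix finSumFinEquiv.symm.injective⟩
  simpa using h.submatrix finSumFinEquiv.injective

theorem blockDiagMat_add {p₁ q₁ p₂ q₂ : ℕ}
    (A A' : Matrix (Fin p₁) (Fin q₁) ℂ) (B B' : Matrix (Fin p₂) (Fin q₂) ℂ) :
    blockDiagMat (A + A') (B + B') = blockDiagMat A B + blockDiagMat A' B' := by
  have h := fromBlocks_add A 0 0 B A' 0 0 B'
  rw [add_zero, add_zero] at h
  exact congrArg (reindex finSumFinEquiv finSumFinEquiv) h.symm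

theorem blockDiagMat_smul {p₁ q₁ p₂ q₂ : ℕ} (c : ℂ)
    (A : Matrix (Fin p₁) (Fin q₁) ℂ) (B : Matrix (Fin p₂) (Fin q₂) ℂ) :
    blockDiagMat (c • A) (c • B) = c • blockDiagMat A B := by
  have h := fromBlocks_smul c A 0 0 B
  rw [smul_zero, smul_zero] at h
  exact congrArg (reindex finSumFinEquiv finSumFinEquiv) h.symm

theorem blockDiagMat_inj {p₁ q₁ p₂ q₂ : ℕ}
    {A A' : Matrix (Fin p₁) (Fin q₁) ℂ} {B B' : Matrix (Fin p₂) (Fin q₂) ℂ} :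
    blockDiagMat A B = blockDiagMat A' B' ↔ A = A' ∧ B = B' := by
  rw [blockDiagMat, blockDiagMat, (reindex _ _).injective.eq_iff, fromBlocks_inj]
  simp

/-- The linear map `(Z¹,Z²,Z³,Z⁴) ↦ ([[Z¹,0],[0,Z²]], [[Z³,0],[0,Z⁴]])`. -/
def blockDiagPair (p₁ q₁ p₂ q₂ p₃ q₃ p₄ q₄ : ℕ) :
    (Matrix (Fin p₁) (Fin q₁) ℂ × Matrix (Fin p₂) (Fin q₂) ℂ ×
      Matrix (Fin p₃) (Fin q₃) ℂ × Matrix (Fin p₄) (Fin q₄) ℂ) →ₗ[ℂ]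
    Matrix (Fin (p₁ + p₂)) (Fin (q₁ + q₂)) ℂ × Matrix (Fin (p₃ + p₄)) (Fin (q₃ + q₄)) ℂ where
  toFun x := (blockDiagMat x.1 x.2.1, blockDiagMat x.2.2.1 x.2.2.2)
  map_add' _ _ := Prod.ext (blockDiagMat_add ..) (blockDiagMat_add ..)
  map_smul' _ _ := Prod.ext (blockDiagMat_smul ..) (blockDiagMat_smul ..)

theorem blockDiagPair_injective (p₁ q₁ p₂ q₂ p₃ q₃ p₄ q₄ : ℕ) :
    Function.Injective (blockDiagPair p₁ q₁ p₂ q₂ p₃ q₃ p₄ q₄) := by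
  rintro ⟨A, B, C, D⟩ ⟨A', B', C', D'⟩ h
  simpa [blockDiagPair, blockDiagMat_inj, and_assoc] using h

/-- `(Z¹,Z²,Z³,Z⁴) ↦ ([[Z¹,0],[0,Z²]], [[Z³,0],[0,Z⁴]])` restricts to a proper holomorphic
map from `D^I_{p₁,q₁} × D^I_{p₂,q₂} × D^I_{p₃,q₃} × D^I_{p₄,q₄}` to
`D^I_{p₁+p₂,q₁+q₂} × D^I_{p₃+p₄,q₃+q₄}`. -/
theorem blockDiag_pair_proper_holomorphic (p₁ q₁ p₂ q₂ p₃ q₃ p₄ q₄ : ℕ)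
    (hp₁ : 0 < p₁) (hq₁ : 0 < q₁) (hp₂ : 0 < p₂) (hq₂ : 0 < q₂)
    (hp₃ : 0 < p₃) (hq₃ : 0 < q₃) (hp₄ : 0 < p₄) (hq₄ : 0 < q₄)
    (hpq₁ : p₁ ≤ q₁) (hpq₂ : p₂ ≤ q₂) (hpq₃ : p₃ ≤ q₃) (hpq₄ : p₄ ≤ q₄) :
    DifferentiableOn ℂ
      (fun x : Matrix (Fin p₁) (Fin q₁) ℂ × Matrix (Fin p₂) (Fin q₂) ℂ ×
          Matrix (Fin p₃) (Fin q₃) ℂ × Matrix (Fin p₄) (Fin q₄) ℂ =>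
        (blockDiagMat x.1 x.2.1, blockDiagMat x.2.2.1 x.2.2.2))
      (typeIDomain p₁ q₁ ×ˢ typeIDomain p₂ q₂ ×ˢ typeIDomain p₃ q₃ ×ˢ typeIDomain p₄ q₄) ∧
    Set.MapsTo
      (fun x : Matrix (Fin p₁) (Fin q₁) ℂ × Matrix (Fin p₂) (Fin q₂) ℂ ×
          Matrix (Fin p₃) (Fin q₃) ℂ × Matrix (Fin p₄) (Fin q₄) ℂ =>
        (blockDiagMat x.1 x.2.1, blockDiagMat x.2.2.1 x.2.2.2))
      (typeIDomain p₁ q₁ ×ˢ typeIDomain p₂ q₂ ×ˢ typeIDomain p₃ q₃ ×ˢ typeIDomain p₄ q₄)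
      (typeIDomain (p₁ + p₂) (q₁ + q₂) ×ˢ typeIDomain (p₃ + p₄) (q₃ + q₄)) ∧
    ∀ K : Set (Matrix (Fin (p₁ + p₂)) (Fin (q₁ + q₂)) ℂ ×
        Matrix (Fin (p₃ + p₄)) (Fin (q₃ + q₄)) ℂ),
      K ⊆ typeIDomain (p₁ + p₂) (q₁ + q₂) ×ˢ typeIDomain (p₃ + p₄) (q₃ + q₄) → IsCompact K →
      IsCompact
        ((fun x : Matrix (Fin p₁) (Fin q₁) ℂ × Matrix (Fin p₂) (Fin q₂) ℂ ×
            Matrix (Fin p₃) (Fin q₃) ℂ × Matrix (Fin p₄) (Fin q₄) ℂ =>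
          (blockDiagMat x.1 x.2.1, blockDiagMat x.2.2.1 x.2.2.2)) ⁻¹' K ∩
          (typeIDomain p₁ q₁ ×ˢ typeIDomain p₂ q₂ ×ˢ typeIDomain p₃ q₃ ×ˢ
            typeIDomain p₄ q₄)) := by
  refine ⟨(LinearMap.toContinuousLinearMap
      (blockDiagPair p₁ q₁ p₂ q₂ p₃ q₃ p₄ q₄)).differentiable.differentiableOn,
    fun x hx => ⟨blockDiagMat_mem_typeIDomain_iff.2 ⟨hx.1, hx.2.1⟩,
      blockDiagMat_mem_typeIDomain_iff.2 hx.2.2⟩, fun K hK hKc => ?_⟩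
  rw [Set.inter_eq_left.2 fun x hx => ?_]
  · exact (LinearMap.isClosedEmbedding_of_injective (LinearMap.ker_eq_bot.2
      (blockDiagPair_injective p₁ q₁ p₂ q₂ p₃ q₃ p₄ q₄))).isCompact_preimage hKc
  · obtain ⟨h₁, h₂⟩ := hK hx
    have h₁ := blockDiagMat_mem_typeIDomain_iff.1 h₁
    exact ⟨h₁.1, h₁.2, blockDiagMat_mem_typeIDomain_iff.1 h₂⟩
end

section
/- Let g : D^I_{2,2} → ℂ be a holomorphic function with |g(Z)| < 1 for all Z ∈ D^I_{2,2}, and let c ∈ ℂ with |c| < 1. Define Φ : D^I_{2,2} → M(3,3;ℂ) by Φ(Z) = [[Z, 0],[0, c·g(Z)]], the 3×3 matrix with top-left 2×2 block Z, bottom-right 1×1 entry c·g(Z), and zero off-diagonal blocks. Then Φ is a proper holomorphic map from D^I_{2,2} to D^I_{3,3}: Φ is holomorphic, Φ(D^I_{2,2}) ⊆ D^I_{3,3}, and, with the subspace topologies, the preimage under Φ of every compact subset of D^I_{3,3} is a compact subset of D^I_{2,2}. -/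
open Matrix
open scoped ComplexOrder

attribute [local instance] Matrix.normedAddCommGroup Matrix.normedSpace

theorem Matrix.PosDef.fromBlocks_diagonal {m n : Type*} [Fintype m] [Fintype n]
    {A : Matrix m m ℂ} {B : Matrix n n ℂ} (hA : A.PosDef) (hB : B.PosDef) :
    (Matrix.fromBlocks A 0 0 B).PosDef := by
  refine .of_dotProduct_mulVec_pos
    (Matrix.IsHermitian.fromBlocks hA.isHermitian (by simp) hB.isHermitian) fun x hx => ?_
  obtain ⟨u, v, rfl⟩ : ∃ u v, x = Sum.elim u v := ⟨_, _, (Sum.elim_comp_inl_inr x).symm⟩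
  have key : star (Sum.elim u v) ⬝ᵥ (Matrix.fromBlocks A 0 0 B *ᵥ Sum.elim u v) =
      star u ⬝ᵥ (A *ᵥ u) + star v ⬝ᵥ (B *ᵥ v) := by
    simp [Matrix.fromBlocks_mulVec, Function.star_sumElim]
  rw [key]
  by_cases hu : u = 0
  · have hv : v ≠ 0 := by
      rintro rfl
      exact hx (by rw [hu]; exact Sum.elim_zero_zero)
    exact add_pos_of_nonneg_of_pos (hA.posSemidef.dotProduct_mulVec_nonneg u)
      (hB.dotProduct_mulVec_pos hv)
  · exact add_pos_of_pos_of_nonneg (hA.dotProduct_mulVec_pos hu)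
      (hB.posSemidef.dotProduct_mulVec_nonneg v)

theorem blockDiagMat_mem_typeIDomain {p₁ q₁ p₂ q₂ : ℕ}
    {A : Matrix (Fin p₁) (Fin q₁) ℂ} {B : Matrix (Fin p₂) (Fin q₂) ℂ}
    (hA : A ∈ typeIDomain p₁ q₁) (hB : B ∈ typeIDomain p₂ q₂) :
    blockDiagMat A B ∈ typeIDomain (p₁ + p₂) (q₁ + q₂) := by
  have h : 1 - (blockDiagMat A B)ᴴ * blockDiagMat A B =
      (Matrix.fromBlocks (1 - Aᴴ * A) 0 0 (1 - Bᴴ * B)).submatrix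
        finSumFinEquiv.symm finSumFinEquiv.symm := by
    rw [blockDiagMat, Matrix.reindex_apply, Matrix.conjTranspose_submatrix,
      Matrix.submatrix_mul_equiv, ← Matrix.submatrix_one_equiv finSumFinEquiv.symm,
      Matrix.fromBlocks_conjTranspose, Matrix.fromBlocks_multiply, ← Matrix.fromBlocks_one]
    ext i j
    induction i using Fin.addCases <;> induction j using Fin.addCases <;>
      simp [-Matrix.fromBlocks_one]
  change (1 - (blockDiagMat A B)ᴴ * blockDiagMat A B).PosDef
  rw [h]
  exact (Matrix.PosDef.fromBlocks_diagonal hA hB).submatrix finSumFinEquiv.symm.injective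

/-- The top-left block of an element of a type-I domain lies in the smaller type-I domain. -/
theorem submatrix_castAdd_mem_typeIDomain {p₁ q₁ p₂ q₂ : ℕ}
    {M : Matrix (Fin (p₁ + p₂)) (Fin (q₁ + q₂)) ℂ} (hM : M ∈ typeIDomain (p₁ + p₂) (q₁ + q₂)) :
    M.submatrix (Fin.castAdd p₂) (Fin.castAdd q₂) ∈ typeIDomain p₁ q₁ := by
  set C := M.submatrix (Fin.natAdd p₁) (Fin.castAdd q₂)
  set A := M.submatrix (Fin.castAdd p₂) (Fin.castAdd q₂)
  have h : 1 - Aᴴ * A = (1 - Mᴴ * M).submatrix (Fin.castAdd q₂) (Fin.castAdd q₂) + Cᴴ * C := by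
    ext i j
    simp [A, C, Matrix.mul_apply, Matrix.one_apply, Fin.sum_univ_add]
    ring
  change (1 - Aᴴ * A).PosDef
  rw [h]
  exact (Matrix.PosDef.submatrix hM (Fin.castAdd_injective q₁ q₂)).add_posSemidef
    (Matrix.posSemidef_conjTranspose_mul_self C)

theorem submatrix_castAdd_blockDiagMat {p₁ q₁ p₂ q₂ : ℕ}
    (A : Matrix (Fin p₁) (Fin q₁) ℂ) (B : Matrix (Fin p₂) (Fin q₂) ℂ) :
    (blockDiagMat A B).submatrix (Fin.castAdd p₂) (Fin.castAdd q₂) = A := by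
  ext i j
  simp [blockDiagMat]

theorem of_const_mem_typeIDomain {w : ℂ} (hw : ‖w‖ < 1) :
    (Matrix.of fun _ _ : Fin 1 => w) ∈ typeIDomain 1 1 := by
  have h : 1 - (Matrix.of fun _ _ : Fin 1 => w)ᴴ * Matrix.of (fun _ _ : Fin 1 => w) =
      Matrix.diagonal fun _ => ((1 - ‖w‖ ^ 2 : ℝ) : ℂ) := by
    ext i j
    fin_cases i; fin_cases j
    simp [Matrix.mul_apply, Complex.conj_mul']
  change (1 - (Matrix.of fun _ _ : Fin 1 => w)ᴴ * Matrix.of (fun _ _ : Fin 1 => w)).PosDef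
  rw [h, Matrix.posDef_diagonal_iff]
  intro _
  rw [Complex.zero_lt_real]
  nlinarith [norm_nonneg w]

theorem DifferentiableOn.blockDiagMat {E : Type*} [NormedAddCommGroup E] [NormedSpace ℂ E]
    {p₁ q₁ p₂ q₂ : ℕ} {s : Set E} {A : E → Matrix (Fin p₁) (Fin q₁) ℂ}
    {B : E → Matrix (Fin p₂) (Fin q₂) ℂ} (hA : DifferentiableOn ℂ A s)
    (hB : DifferentiableOn ℂ B s) :
    DifferentiableOn ℂ (fun x => blockDiagMat (A x) (B x)) s := by
  refine differentiableOn_pi.2 fun i => differentiableOn_pi.2 fun j => ?_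
  induction i using Fin.addCases <;> induction j using Fin.addCases <;>
    simp only [_root_.blockDiagMat, Matrix.reindex_apply, Matrix.submatrix_apply,
      finSumFinEquiv_symm_apply_castAdd, finSumFinEquiv_symm_apply_natAdd,
      Matrix.fromBlocks_apply₁₁, Matrix.fromBlocks_apply₁₂, Matrix.fromBlocks_apply₂₁,
      Matrix.fromBlocks_apply₂₂, Matrix.zero_apply]
  · exact differentiableOn_pi.1 (differentiableOn_pi.1 hA _) _
  · exact differentiableOn_const _
  · exact differentiableOn_const _
  · exact differentiableOn_pi.1 (differentiableOn_pi.1 hB _) _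

/-- If `g` is holomorphic on `D^I_{2,2}` with `|g| < 1` there and `|c| < 1`, then
`Φ(Z) = [[Z,0],[0,c·g(Z)]]` is a proper holomorphic map from `D^I_{2,2}` to `D^I_{3,3}`. -/
theorem blockDiag_scalar_proper_holomorphic
    (g : Matrix (Fin 2) (Fin 2) ℂ → ℂ)
    (hg : DifferentiableOn ℂ g (typeIDomain 2 2))
    (hg1 : ∀ Z ∈ typeIDomain 2 2, ‖g Z‖ < 1)
    (c : ℂ) (hc : ‖c‖ < 1) :
    DifferentiableOn ℂ
      (fun Z : Matrix (Fin 2) (Fin 2) ℂ =>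
        blockDiagMat Z (Matrix.of fun _ _ : Fin 1 => c * g Z))
      (typeIDomain 2 2) ∧
    Set.MapsTo
      (fun Z : Matrix (Fin 2) (Fin 2) ℂ =>
        blockDiagMat Z (Matrix.of fun _ _ : Fin 1 => c * g Z))
      (typeIDomain 2 2) (typeIDomain 3 3) ∧
    ∀ K : Set (Matrix (Fin 3) (Fin 3) ℂ),
      K ⊆ typeIDomain 3 3 → IsCompact K →
      IsCompact
        ((fun Z : Matrix (Fin 2) (Fin 2) ℂ =>
          blockDiagMat Z (Matrix.of fun _ _ : Fin 1 => c * g Z)) ⁻¹' K ∩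
          typeIDomain 2 2) := by
  have hd : DifferentiableOn ℂ
      (fun Z : Matrix (Fin 2) (Fin 2) ℂ =>
        blockDiagMat Z (Matrix.of fun _ _ : Fin 1 => c * g Z)) (typeIDomain 2 2) :=
    differentiableOn_id.blockDiagMat
      (differentiableOn_pi.2 fun _ => differentiableOn_pi.2 fun _ => hg.const_mul c)
  refine ⟨hd, fun Z hZ => blockDiagMat_mem_typeIDomain hZ (of_const_mem_typeIDomain ?_), ?_⟩
  · rw [norm_mul]
    exact mul_lt_one_of_nonneg_of_lt_one_left (norm_nonneg c) hc (hg1 Z hZ).le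
  intro K hK hKc
  let π : Matrix (Fin 3) (Fin 3) ℂ → Matrix (Fin 2) (Fin 2) ℂ :=
    fun M => M.submatrix (Fin.castAdd 1) (Fin.castAdd 1)
  have hπ : Continuous π := continuous_id.matrix_submatrix _ _
  have hL : IsCompact (π '' K) := hKc.image hπ
  have hLD : π '' K ⊆ typeIDomain 2 2 := by
    rintro _ ⟨M, hM, rfl⟩
    exact submatrix_castAdd_mem_typeIDomain (hK hM)
  have hclosed := (hd.continuousOn.mono hLD).preimage_isClosed_of_isClosed hL.isClosed hKc.isClosed
  convert hL.of_isClosed_subset hclosed Set.inter_subset_left using 1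
  ext Z
  exact ⟨fun ⟨hZK, _⟩ => ⟨⟨_, hZK, submatrix_castAdd_blockDiagMat _ _⟩, hZK⟩,
    fun ⟨hZL, hZK⟩ => ⟨hZK, hLD hZL⟩⟩
end

section
/- Let m, n be positive integers, let Δ = {z ∈ ℂ : |z| < 1} be the open unit disk, let U ⊂ ℂᵐ be a bounded connected open set with 0 ∈ U, and let 𝔹ⁿ ⊂ ℂⁿ be the open unit ball. Let F : Δ × U → 𝔹ⁿ be a holomorphic map such that the map F₀ : Δ → 𝔹ⁿ, F₀(z) := F(z,0), is proper (i.e., with the subspace topologies, the preimage under F₀ of every compact subset of 𝔹ⁿ is a compact subset of Δ). Then F does not depend on its second argument: F(z,w) = F(z,0) for every (z,w) ∈ Δ × U. -/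
open Metric Set in
/-- A holomorphic map `g` from the disk of radius `2` to the unit ball of a complex inner product
space satisfies `‖g 1 - g 0‖ ^ 2 ≤ 6 * (1 - ‖g 0‖)`. -/
theorem norm_sub_sq_le_of_mapsTo_unit_ball {E : Type*} [NormedAddCommGroup E]
    [InnerProductSpace ℂ E] {g : ℂ → E} (hg : DifferentiableOn ℂ g (ball 0 2))
    (hmaps : MapsTo g (ball 0 2) (ball 0 1)) :
    ‖g 1 - g 0‖ ^ 2 ≤ 6 * (1 - ‖g 0‖) := by
  have h0 : ‖g 0‖ < 1 := mem_ball_zero_iff.1 (hmaps (by simp))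
  have h1 : ‖g 1‖ < 1 := mem_ball_zero_iff.1 (hmaps (by simp))
  rcases (norm_nonneg (g 0)).eq_or_lt' with hs | hs
  · rw [norm_eq_zero.1 hs]
    simp only [sub_zero, norm_zero]
    nlinarith [norm_nonneg (g 1)]
  have hM : 0 < ‖g 0‖ - ‖g 0‖ ^ 2 := by nlinarith
  have hself : inner ℂ (g 0) (g 0) = ((‖g 0‖ ^ 2 : ℝ) : ℂ) := by
    rw [inner_self_eq_norm_sq_to_K]; norm_cast
  have key := Complex.borelCaratheodory_zero (f := fun x ↦ inner ℂ (g 0) (g x - g 0)) (z := 1) hM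
    ((innerSL ℂ (g 0)).differentiable.comp_differentiableOn
      (hg.sub (differentiableOn_const (g 0)))) (by
        intro x hx
        have hx1 : ‖g x‖ < 1 := mem_ball_zero_iff.1 (hmaps hx)
        have hle : (inner ℂ (g 0) (g x)).re ≤ ‖g 0‖ * ‖g x‖ := re_inner_le_norm (𝕜 := ℂ) _ _
        simp only [mem_ofPred_eq, inner_sub_right, hself, Complex.sub_re, Complex.ofReal_re]
        nlinarith) (by norm_num) (by simp) (by simp)
  have hre := (abs_le.1 ((Complex.abs_re_le_norm _).trans key)).1
  simp only [inner_sub_right, hself, Complex.sub_re, Complex.ofReal_re, norm_one] at hre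
  have hexp := norm_sub_sq (𝕜 := ℂ) (g 0) (g 1)
  rw [norm_sub_rev] at hexp
  simp only [RCLike.re_to_complex] at hexp
  rw [hexp]
  nlinarith [norm_nonneg (g 1)]

open Metric Set in
/-- A holomorphic function on the unit disk which tends to zero at the boundary vanishes. -/
theorem eq_zero_of_small_near_unit_circle {E : Type*} [NormedAddCommGroup E] [NormedSpace ℂ E]
    {G : ℂ → E} (hG : DifferentiableOn ℂ G (ball 0 1))
    (hsmall : ∀ ε > 0, ∃ K ⊆ ball (0 : ℂ) 1, IsCompact K ∧
      ∀ z ∈ ball (0 : ℂ) 1, z ∉ K → ‖G z‖ ≤ ε)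
    {z : ℂ} (hz : z ∈ ball (0 : ℂ) 1) : G z = 0 := by
  refine norm_le_zero_iff.1 (le_of_forall_pos_le_add fun ε hε ↦ ?_)
  obtain ⟨K, hK1, hK, hKG⟩ := hsmall ε hε
  obtain ⟨r, hr1, hr⟩ := exists_lt_subset_ball
    (s := insert z K) (x := (0 : ℂ)) (r := 1) (hK.insert z).isClosed (insert_subset hz hK1)
  have hzr := hr (mem_insert z K)
  have hr0 : r ≠ 0 := (pos_of_mem_ball hzr).ne'
  have hcl : closure (ball (0 : ℂ) r) ⊆ ball 0 1 :=
    closure_ball_subset_closedBall.trans (closedBall_subset_ball hr1)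
  rw [zero_add]
  refine Complex.norm_le_of_forall_mem_frontier_norm_le isBounded_ball
    (hG.mono hcl).diffContOnCl (fun x hx ↦ hKG x (hcl (frontier_subset_closure hx)) fun hxK ↦ ?_)
    (subset_closure hzr)
  rw [frontier_ball _ hr0] at hx
  have := hr (mem_insert_of_mem z hxK)
  rw [mem_ball, mem_sphere.1 hx] at this
  exact lt_irrefl _ this

open Metric Set in
/-- If the slice of `F` at `w₀` is proper from the unit disk to the unit ball, then the slices of
`F` at `w₀` and at any sufficiently close point agree. -/
theorem eq_slice_of_proper_slice {V E : Type*} [NormedAddCommGroup V] [NormedSpace ℂ V]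
    [NormedAddCommGroup E] [InnerProductSpace ℂ E] [ProperSpace E] {U : Set V} {F : ℂ × V → E}
    (hF : DifferentiableOn ℂ F (ball (0 : ℂ) 1 ×ˢ U))
    (hmaps : MapsTo F (ball (0 : ℂ) 1 ×ˢ U) (ball 0 1)) {w₀ w : V} {R : ℝ}
    (hball : ball w₀ R ⊆ U) (hw : 2 * dist w w₀ < R)
    (hproper : ∀ K : Set E, K ⊆ ball 0 1 → IsCompact K →
      IsCompact ((fun z : ℂ ↦ F (z, w₀)) ⁻¹' K ∩ ball (0 : ℂ) 1))
    {z : ℂ} (hz : z ∈ ball (0 : ℂ) 1) : F (z, w) = F (z, w₀) := by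
  have hslice : ∀ v ∈ U, DifferentiableOn ℂ (fun z : ℂ ↦ F (z, v)) (ball 0 1) := fun v hv ↦
    hF.comp (by fun_prop) fun x hx ↦ ⟨hx, hv⟩
  have hd : 0 ≤ dist w w₀ := dist_nonneg
  have hwU : w ∈ U := hball (mem_ball.2 (by linarith))
  have hw₀U : w₀ ∈ U := hball (mem_ball_self (by linarith))
  have hline : ∀ x ∈ ball (0 : ℂ) 2, w₀ + x • (w - w₀) ∈ U := fun x hx ↦ by
    refine hball ?_
    rw [mem_ball, dist_eq_norm, add_sub_cancel_left, norm_smul, ← dist_eq_norm]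
    have := mem_ball_zero_iff.1 hx
    nlinarith
  have hbound : ∀ x ∈ ball (0 : ℂ) 1, ‖F (x, w) - F (x, w₀)‖ ^ 2 ≤ 6 * (1 - ‖F (x, w₀)‖) := by
    intro x hx
    have := norm_sub_sq_le_of_mapsTo_unit_ball (g := fun t : ℂ ↦ F (x, w₀ + t • (w - w₀)))
      (hF.comp (by fun_prop) fun t ht ↦ ⟨hx, hline t ht⟩) fun t ht ↦ hmaps ⟨hx, hline t ht⟩
    simpa using this
  refine sub_eq_zero.1 (eq_zero_of_small_near_unit_circle (G := fun z ↦ F (z, w) - F (z, w₀))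
    ((hslice w hwU).sub (hslice w₀ hw₀U)) (fun ε hε ↦ ?_) hz)
  refine ⟨_, inter_subset_right, hproper (closedBall 0 (1 - ε ^ 2 / 6))
    (closedBall_subset_ball (by have := pow_pos hε 2; linarith)) (isCompact_closedBall _ _),
    fun x hx hxK ↦ ?_⟩
  have hlt : 1 - ε ^ 2 / 6 < ‖F (x, w₀)‖ := by
    by_contra! h
    exact hxK ⟨mem_closedBall_zero_iff.2 h, hx⟩
  exact le_of_sq_le_sq (by linarith [hbound x hx]) hε.le


/-- If `F : Δ × U → 𝔹ⁿ` is holomorphic, where `U ⊂ ℂᵐ` is a bounded connected open set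
containing `0`, and `z ↦ F(z,0)` is a proper map from `Δ` to `𝔹ⁿ`, then `F` does not
depend on its second argument. -/
theorem holomorphic_indep_of_proper_slice (m n : ℕ) (hm : 0 < m) (hn : 0 < n)
    (U : Set (EuclideanSpace ℂ (Fin m)))
    (hUopen : IsOpen U) (hUconn : IsConnected U)
    (hUbdd : Bornology.IsBounded U) (hU0 : (0 : EuclideanSpace ℂ (Fin m)) ∈ U)
    (F : ℂ × EuclideanSpace ℂ (Fin m) → EuclideanSpace ℂ (Fin n))
    (hF : DifferentiableOn ℂ F ((Metric.ball (0 : ℂ) 1) ×ˢ U))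
    (hFmaps : Set.MapsTo F ((Metric.ball (0 : ℂ) 1) ×ˢ U)
      (Metric.ball (0 : EuclideanSpace ℂ (Fin n)) 1))
    (hproper : ∀ K : Set (EuclideanSpace ℂ (Fin n)),
      K ⊆ Metric.ball (0 : EuclideanSpace ℂ (Fin n)) 1 → IsCompact K →
      IsCompact ((fun z : ℂ => F (z, 0)) ⁻¹' K ∩ Metric.ball (0 : ℂ) 1)) :
    ∀ z ∈ Metric.ball (0 : ℂ) 1, ∀ w ∈ U, F (z, w) = F (z, 0) := by
  have hstep : ∀ w₀ w : EuclideanSpace ℂ (Fin m), ∀ R : ℝ, Metric.ball w₀ R ⊆ U →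
      2 * dist w w₀ < R → (∀ z ∈ Metric.ball (0 : ℂ) 1, F (z, w₀) = F (z, 0)) →
      ∀ z ∈ Metric.ball (0 : ℂ) 1, F (z, w) = F (z, 0) := by
    intro w₀ w R hball hw hw₀ z hz
    rw [← hw₀ z hz]
    refine eq_slice_of_proper_slice hF hFmaps hball hw (fun K hK hKc ↦ ?_) hz
    convert hproper K hK hKc using 1
    ext x
    simp only [Set.mem_inter_iff, Set.mem_preimage]
    exact and_congr_left fun hx ↦ by rw [hw₀ x hx]
  let A : Set (EuclideanSpace ℂ (Fin m)) :=
    {w | w ∈ U ∧ ∀ z ∈ Metric.ball (0 : ℂ) 1, F (z, w) = F (z, 0)}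
  suffices hUA : U ⊆ A from fun z hz w hw ↦ (hUA hw).2 z hz
  refine hUconn.isPreconnected.subset_of_closure_inter_subset ?_ ⟨0, hU0, hU0, fun _ _ ↦ rfl⟩ ?_
  · refine Metric.isOpen_iff.2 fun w₀ hw₀ ↦ ?_
    obtain ⟨R, hR, hball⟩ := Metric.isOpen_iff.1 hUopen w₀ hw₀.1
    refine ⟨R / 2, half_pos hR, fun w hw ↦ ?_⟩
    have hw' := Metric.mem_ball.1 hw
    exact ⟨hball (Metric.mem_ball.2 (by linarith)),
      hstep w₀ w R hball (by linarith) hw₀.2⟩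
  · rintro w ⟨hwA, hwU⟩
    obtain ⟨R, hR, hball⟩ := Metric.isOpen_iff.1 hUopen w hwU
    obtain ⟨w₀, hw₀, hdist⟩ := Metric.mem_closure_iff.1 hwA (R / 4) (by linarith)
    refine ⟨hwU, hstep w₀ w (3 * R / 4) ((Metric.ball_subset_ball' ?_).trans hball)
      (by linarith) hw₀.2⟩
    rw [dist_comm]; linarith
end
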